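/- Let f ∈ 𝔽_{2ⁿ}[x] be a polynomial of degree m ≥ 7 and let α ∈ 𝔽_{2ⁿ}\{0}. Then there exists a unique polynomial L ∈ 𝔽_{2ⁿ}[x] of degree at most (m−1)/2 such that L(x(x+α)) = f(x+α) − f(x) as polynomials in 𝔽_{2ⁿ}[x]. -/

import Mathlib

open Polynomial

lemma natDegree_X_mul_X_add_C {K : Type*} [Field K] (α : K) :
    (X * (X + C α) : K[X]).natDegree = 2 := by
  rw [natDegree_mul X_ne_zero (X_add_C_ne_zero α), natDegree_X, natDegree_X_add_C]

lemma comp_X_mul_X_add_C_injective {K : Type*} [Field K] (α : K) :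
    Function.Injective fun L : K[X] => L.comp (X * (X + C α)) := by
  intro p q h
  have h0 : (p - q).comp (X * (X + C α)) = 0 := by
    rw [sub_comp]
    exact sub_eq_zero.2 h
  rcases comp_eq_zero_iff.1 h0 with h1 | ⟨-, h1⟩
  · exact sub_eq_zero.1 h1
  · have h2 := congrArg natDegree h1
    rw [natDegree_X_mul_X_add_C, natDegree_C] at h2
    omega

lemma X_mul_X_add_C_comp_X_add_C {K : Type*} [Field K] [CharP K 2] (α : K) :
    (X * (X + C α) : K[X]).comp (X + C α) = X * (X + C α) := by
  simp only [mul_comp, add_comp, X_comp, C_comp]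
  rw [add_assoc, CharTwo.add_self_eq_zero, add_zero, mul_comm]

/-- In characteristic two, a polynomial invariant under translation by `α ≠ 0` is a polynomial
in `X * (X + α)`. -/
lemma exists_comp_X_mul_X_add_C_eq {K : Type*} [Field K] [CharP K 2] {α : K} (hα : α ≠ 0)
    (g : K[X]) (hg : g.comp (X + C α) = g) :
    ∃ L : K[X], L.comp (X * (X + C α)) = g := by
  induction hd : g.natDegree using Nat.strong_induction_on generalizing g with
  | _ d ih =>
    have heval : g.eval α = g.eval 0 := by
      conv_rhs => rw [← hg]
      simp [eval_comp]
    have hX : (X : K[X]) ∣ g - C (g.eval 0) := by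
      simpa using (dvd_iff_isRoot (p := g - C (g.eval 0)) (a := 0)).2 (by simp)
    have hXα : (X + C α : K[X]) ∣ g - C (g.eval 0) := by
      have := (dvd_iff_isRoot (p := g - C (g.eval 0)) (a := α)).2 (by simp [heval])
      rwa [CharTwo.sub_eq_add] at this
    have hcop : IsCoprime (X : K[X]) (X + C α) := by
      have := isCoprime_X_sub_C_of_isUnit_sub (a := (0 : K)) (b := α) (by simpa using hα)
      rwa [C_0, sub_zero, CharTwo.sub_eq_add] at this
    obtain ⟨h, hh⟩ := hcop.mul_dvd hX hXα
    have hq : (X * (X + C α) : K[X]) ≠ 0 := mul_ne_zero X_ne_zero (X_add_C_ne_zero α)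
    by_cases h0 : h = 0
    · refine ⟨C (g.eval 0), ?_⟩
      rw [h0, mul_zero] at hh
      rw [C_comp, ← sub_eq_zero.1 hh]
    have hinv : h.comp (X + C α) = h := by
      apply mul_left_cancel₀ hq
      have := congrArg (fun p : K[X] => p.comp (X + C α)) hh
      simp only [sub_comp, C_comp, hg] at this
      rw [mul_comp, X_mul_X_add_C_comp_X_add_C] at this
      rw [← this, hh]
    have hdeg : h.natDegree < d := by
      have := congrArg natDegree hh
      rw [natDegree_sub_C, natDegree_mul hq h0, natDegree_X_mul_X_add_C] at this
      omega
    obtain ⟨L, hL⟩ := ih _ hdeg h hinv rfl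
    refine ⟨X * L + C (g.eval 0), ?_⟩
    rw [add_comp, mul_comp, X_comp, C_comp, hL, ← hh, sub_add_cancel]

lemma natDegree_comp_X_add_C_sub_lt {K : Type*} [Field K] (f : K[X]) (hf : 0 < f.natDegree)
    (α : K) : (f.comp (X + C α) - f).natDegree < f.natDegree := by
  have hn : (f.comp (X + C α)).natDegree = f.natDegree := by
    rw [natDegree_comp, natDegree_X_add_C, mul_one]
  have hf0 : f ≠ 0 := ne_zero_of_natDegree_gt hf
  have hc0 : f.comp (X + C α) ≠ 0 := ne_zero_of_natDegree_gt (hn ▸ hf)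
  by_cases h0 : f.comp (X + C α) - f = 0
  · simpa [h0] using hf
  rw [← hn]
  refine natDegree_lt_natDegree h0 (degree_sub_lt_left ?_ hc0 ?_)
  · rw [degree_eq_natDegree hc0, degree_eq_natDegree hf0, hn]
  · rw [leadingCoeff_comp (by rw [natDegree_X_add_C]; exact one_ne_zero), leadingCoeff_X_add_C,
      one_pow, mul_one]

/-- Let `f ∈ 𝔽_{2^n}[x]` have degree `m ≥ 7` and let `α ∈ 𝔽_{2^n} \ {0}`.  There exists a
unique polynomial `L ∈ 𝔽_{2^n}[x]` of degree at most `(m-1)/2` (floor division) such that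
`L(x(x+α)) = f(x+α) - f(x)` as polynomials. -/
theorem existsUnique_L_alpha (n m : ℕ) (hm : 7 ≤ m)
    (f : Polynomial (GaloisField 2 n)) (hf : f.natDegree = m)
    (α : GaloisField 2 n) (hα : α ≠ 0) :
    ∃! L : Polynomial (GaloisField 2 n),
      L.natDegree ≤ (m - 1) / 2 ∧ L.comp (X * (X + C α)) = f.comp (X + C α) - f := by
  have hinv : (f.comp (X + C α) - f).comp (X + C α) = f.comp (X + C α) - f := by
    rw [sub_comp, comp_assoc, add_comp, X_comp, C_comp, add_assoc, CharTwo.add_self_eq_zero,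
      add_zero, comp_X, CharTwo.sub_eq_add, CharTwo.sub_eq_add, add_comm]
  obtain ⟨L, hL⟩ := exists_comp_X_mul_X_add_C_eq hα _ hinv
  refine ⟨L, ⟨?_, hL⟩, fun L' hL' => comp_X_mul_X_add_C_injective α (hL'.2.trans hL.symm)⟩
  have hlt := natDegree_comp_X_add_C_sub_lt f (by omega) α
  rw [← hL, natDegree_comp, natDegree_X_mul_X_add_C, hf] at hlt
  omega
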